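/- arXiv:2312.14341 — 2 statements merged into one kernel-verified Lean document; each statement's English description precedes it below -/
import Mathlib

section
/- Suppose Assumptions 1 and 2 hold, let (x^k, y^k, z^k, u^k, θ_k)_{k≥0} be generated by the constant-parameter algorithm, and let K₁ be an index such that 0 < m ≤ ⟨Kx^k, y^k⟩ − f*(y^k) ≤ f(Kx^k) ≤ M for all k ≥ K₁. Then, with c := min(ν, δ(2−β)/(2β), γ/2)/M, for all k ≥ K₁: Γ(x^{k+1}, y^{k+1}, z^{k+1}, u^{k+1}) ≤ Γ(x^k, y^k, z^k, u^k) − c‖x^k−x^{k+1}‖² − c‖u^k−u^{k+1}‖² − c‖z^k−z^{k+1}‖². -/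
open Set Filter Topology Metric

open scoped RealInnerProductSpace

noncomputable section

namespace FracPaper

variable {E : Type*} [NormedAddCommGroup E] [InnerProductSpace ℝ E] [FiniteDimensional ℝ E]
variable {F : Type*} [NormedAddCommGroup F] [InnerProductSpace ℝ F] [FiniteDimensional ℝ F]
variable {G : Type*} [NormedAddCommGroup G] [InnerProductSpace ℝ G] [FiniteDimensional ℝ G]

/-- The effective domain of an `EReal`-valued function. -/
def edom (f : E → EReal) : Set E := {x | f x ≠ ⊤}

/-- `f` is proper: it takes values in `ℝ ∪ {+∞}` and is not identically `+∞`. -/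
def ProperFn (f : E → EReal) : Prop := (∀ x, f x ≠ ⊥) ∧ ∃ x, f x ≠ ⊤

/-- Convexity for `EReal`-valued functions. -/
def ConvexFn (f : E → EReal) : Prop :=
  ∀ x y : E, ∀ a b : ℝ, 0 ≤ a → 0 ≤ b → a + b = 1 →
    f (a • x + b • y) ≤ (a : EReal) * f x + (b : EReal) * f y

/-- The Fenchel conjugate of an `EReal`-valued function. -/
def conj (f : E → EReal) : E → EReal :=
  fun v => ⨆ x : E, ((⟪v, x⟫ : EReal) - f x)

/-- The `ε`-subdifferential (for convex functions). -/
def epsSubdiff (f : E → EReal) (ε : ℝ) (w : E) : Set E :=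
  {v | f w ≠ ⊤ ∧ ∀ y : E, f w + ((⟪v, y - w⟫ - ε : ℝ) : EReal) ≤ f y}

/-- The convex subdifferential. -/
def subdiff (f : E → EReal) (w : E) : Set E := epsSubdiff f 0 w

/-- The Fréchet subdifferential. -/
def frechetSubdiff (f : E → EReal) (w : E) : Set E :=
  {v | f w ≠ ⊤ ∧ ∀ ε : ℝ, 0 < ε →
    ∀ᶠ y in nhds w, f w + ((⟪v, y - w⟫ - ε * ‖y - w‖ : ℝ) : EReal) ≤ f y}

/-- The limiting (Mordukhovich) subdifferential. -/
def limitingSubdiff (f : E → EReal) (w : E) : Set E :=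
  {v | ∃ xs vs : ℕ → E,
      Tendsto xs atTop (nhds w) ∧
      Tendsto (fun k => f (xs k)) atTop (nhds (f w)) ∧
      Tendsto vs atTop (nhds v) ∧
      ∀ k, vs k ∈ frechetSubdiff f (xs k)}

open Classical in
/-- The indicator function of a set, with values in `EReal`. -/
def indicatorFn (S : Set E) : E → EReal := fun x => if x ∈ S then (0 : EReal) else ⊤

/-- Calmness of an `EReal`-valued function at a point. -/
def CalmAt (f : E → EReal) (x : E) : Prop :=
  ∃ ε κ : ℝ, 0 < ε ∧ 0 < κ ∧ ∀ y ∈ ball x ε,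
    f y ≤ f x + ((κ * ‖y - x‖ : ℝ) : EReal) ∧ f x ≤ f y + ((κ * ‖y - x‖ : ℝ) : EReal)

/-- Essential strict convexity: strict convexity on every convex subset of `dom ∂g`. -/
def EssStrictConvexFn (g : F → EReal) : Prop :=
  ∀ C : Set F, Convex ℝ C → (∀ w ∈ C, (subdiff g w).Nonempty) →
    ∀ x ∈ C, ∀ y ∈ C, x ≠ y → ∀ a b : ℝ, 0 < a → 0 < b → a + b = 1 →
      g (a • x + b • y) < (a : EReal) * g x + (b : EReal) * g y

/-- The Kurdyka–Łojasiewicz property at a point. -/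
def KLAt (f : E → EReal) (xh : E) : Prop :=
  ∃ μ : ℝ, 0 < μ ∧ ∃ U ∈ nhds xh, ∃ φ φd : ℝ → ℝ,
    ContinuousOn φ (Ico 0 μ) ∧ ConcaveOn ℝ (Ico 0 μ) φ ∧ φ 0 = 0 ∧
    (∀ t ∈ Ioo 0 μ, HasDerivAt φ (φd t) t ∧ 0 < φd t) ∧
    ∀ x ∈ U, f xh < f x → f x < f xh + (μ : EReal) →
      ∀ v ∈ limitingSubdiff f x, 1 ≤ φd ((f x).toReal - (f xh).toReal) * ‖v‖

/-- The augmented function `Ψ`. -/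
def psi (S : Set E) (g : F → EReal) (h : E → ℝ) (A : E →L[ℝ] F) (δ γ : ℝ)
    (x : E) (z : F) (u : E) : EReal :=
  ((⟪z, A x⟫ + h x + δ / 2 * ‖x - u‖ ^ 2 - γ / 2 * ‖z‖ ^ 2 : ℝ) : EReal)
    - conj g z + indicatorFn S x

/-- Assumption 1 of the paper. `h'` is the gradient of `h` and `Lh` its Lipschitz constant. -/
def Assumption1 (S : Set E) (g : F → EReal) (h : E → ℝ) (h' : E → E) (Lh : ℝ)
    (f : G → EReal) (A : E →L[ℝ] F) (K : E →L[ℝ] G) : Prop :=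
  S.Nonempty ∧ Convex ℝ S ∧ IsCompact S ∧
  ProperFn g ∧ ConvexFn g ∧ LowerSemicontinuous g ∧
  (∃ O : Set E, IsOpen O ∧ S ⊆ O ∧ (∀ x ∈ O, HasGradientAt h (h' x) x) ∧
      ∀ x ∈ O, ∀ y ∈ O, ‖h' x - h' y‖ ≤ Lh * ‖x - y‖) ∧
  ProperFn f ∧ ConvexFn f ∧ LowerSemicontinuous f ∧
  (∀ x ∈ S, K x ∈ interior (edom f)) ∧ (∀ x ∈ S, 0 < f (K x)) ∧
  (∃ x ∈ S, A x ∈ edom g) ∧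
  (∃ α : ℝ, 0 < α ∧ ∀ x ∈ S, (α : EReal) ≤ g (A x) + (h x : EReal))

/-- Assumption 2 of the paper. -/
def Assumption2 (S : Set E) (g : F → EReal) (A : E →L[ℝ] F) : Prop :=
  (∀ x ∈ S, (subdiff g (A x)).Nonempty) ∧
  ∃ ℓ : ℝ, 0 < ℓ ∧ ∀ x ∈ S, infDist 0 (subdiff g (A x)) ≤ ℓ

/-- The constant-parameter algorithm (FSPS with fixed `γ`, `δ`, `β`). -/
def IsAlgoSeq (S : Set E) (g : F → EReal) (h : E → ℝ) (h' : E → E) (f : G → EReal)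
    (A : E →L[ℝ] F) (K : E →L[ℝ] G) (γ δ β : ℝ)
    (x u : ℕ → E) (y : ℕ → G) (z : ℕ → F) (θ : ℕ → ℝ) : Prop :=
  x 0 ∈ S ∧
  (∀ k, ∀ ζ : F, conj g (z k) + ((-⟪z k, A (x k)⟫ + γ / 2 * ‖z k‖ ^ 2 : ℝ) : EReal)
      ≤ conj g ζ + ((-⟪ζ, A (x k)⟫ + γ / 2 * ‖ζ‖ ^ 2 : ℝ) : EReal)) ∧
  (∀ k, 0 < θ k ∧ ((θ k : ℝ) : EReal) * f (K (x k)) = psi S g h A δ γ (x k) (z k) (u k)) ∧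
  (∀ k, y (k + 1) ∈ subdiff f (K (x k))) ∧
  (∀ k, x (k + 1) ∈ S ∧ ∀ w ∈ S,
      ⟪z k, A (x (k + 1))⟫ - θ k * ⟪K (x (k + 1)), y (k + 1)⟫
          + ⟪h' (x k), x (k + 1)⟫ + δ / 2 * ‖x (k + 1) - u k‖ ^ 2
        ≤ ⟪z k, A w⟫ - θ k * ⟪K w, y (k + 1)⟫ + ⟪h' (x k), w⟫
          + δ / 2 * ‖w - u k‖ ^ 2) ∧
  (∀ k, u (k + 1) = (1 - β) • u k + β • x (k + 1))

/-- `x̄` is a limiting `(ε₁, ε₂)`-lifted stationary point of the fractional program. -/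
def IsLiftedStat (S : Set E) (g : F → EReal) (h : E → ℝ) (h' : E → E) (f : G → EReal)
    (A : E →L[ℝ] F) (K : E →L[ℝ] G) (ε₁ ε₂ : ℝ) (xb : E) : Prop :=
  ∃ Ψb : ℝ, |Ψb - ((g (A xb)).toReal + h xb)| ≤ ε₂ ∧
    ∃ v ∈ epsSubdiff g ε₁ (A xb), ∃ w ∈ subdiff (indicatorFn S) xb,
      ∃ s ∈ subdiff f (K xb),
        (f (K xb)).toReal • (ContinuousLinearMap.adjoint A v + h' xb + w)
          - Ψb • (ContinuousLinearMap.adjoint K s) = 0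


/-- The merit function `Π` evaluated componentwise. -/
def piPt (S : Set E) (g : F → EReal) (h : E → ℝ) (f : G → EReal)
    (A : E →L[ℝ] F) (K : E →L[ℝ] G) (δ γ : ℝ) (x : E) (z : F) (u : E) : EReal :=
  psi S g h A δ γ x z u / f (K x)

/-- The merit function `Γ` evaluated componentwise. -/
def gamPt (S : Set E) (g : F → EReal) (h : E → ℝ) (f : G → EReal)
    (A : E →L[ℝ] F) (K : E →L[ℝ] G) (δ γ : ℝ) (x : E) (y : G) (z : F) (u : E) : EReal :=
  psi S g h A δ γ x z u / (((⟪K x, y⟫ : ℝ) : EReal) - conj f y)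

/-- Quadratic growth at `a`, from minimality of `a` along the segment towards `b`. -/
lemma quadratic_growth_of_le_segment {V : Type*} [NormedAddCommGroup V] [InnerProductSpace ℝ V]
    {pa pb κ : ℝ} {w a b : V}
    (hseg : ∀ t ∈ Ioo (0 : ℝ) 1, pa + κ / 2 * ‖a - w‖ ^ 2 ≤
      (1 - t) * pa + t * pb + κ / 2 * ‖((1 - t) • a + t • b) - w‖ ^ 2) :
    pa + κ / 2 * ‖a - w‖ ^ 2 + κ / 2 * ‖b - a‖ ^ 2 ≤ pb + κ / 2 * ‖b - w‖ ^ 2 := by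
  have hdiv : ∀ t ∈ Ioo (0 : ℝ) 1,
      pa + κ / 2 * ‖a - w‖ ^ 2 + (1 - t) * (κ / 2 * ‖b - a‖ ^ 2) ≤
        pb + κ / 2 * ‖b - w‖ ^ 2 := by
    intro t ht
    have hexp : ‖((1 - t) • a + t • b) - w‖ ^ 2 =
        (1 - t) * ‖a - w‖ ^ 2 + t * ‖b - w‖ ^ 2 - t * (1 - t) * ‖b - a‖ ^ 2 := by
      have e1 : ((1 - t) • a + t • b) - w = (1 - t) • (a - w) + t • (b - w) := by module
      have e2 : b - a = (b - w) - (a - w) := by abel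
      rw [e1, e2, norm_add_sq_real, norm_sub_sq_real (b - w), norm_smul, norm_smul, inner_smul_left,
        inner_smul_right, mul_pow, mul_pow, Real.norm_eq_abs, Real.norm_eq_abs, sq_abs, sq_abs,
        real_inner_comm (a - w)]
      simp only [conj_trivial]
      ring
    have h1 := hseg t ht
    rw [hexp] at h1
    have h2 : t * (pa + κ / 2 * ‖a - w‖ ^ 2 + (1 - t) * (κ / 2 * ‖b - a‖ ^ 2)) ≤
        t * (pb + κ / 2 * ‖b - w‖ ^ 2) := by linarith
    exact le_of_mul_le_mul_left h2 ht.1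
  have hlim : Tendsto
      (fun t : ℝ => pa + κ / 2 * ‖a - w‖ ^ 2 + (1 - t) * (κ / 2 * ‖b - a‖ ^ 2))
      (𝓝[>] 0) (𝓝 (pa + κ / 2 * ‖a - w‖ ^ 2 + κ / 2 * ‖b - a‖ ^ 2)) := by
    have hc : Continuous
        (fun t : ℝ => pa + κ / 2 * ‖a - w‖ ^ 2 + (1 - t) * (κ / 2 * ‖b - a‖ ^ 2)) := by
      fun_prop
    simpa using (hc.tendsto 0).mono_left nhdsWithin_le_nhds
  exact le_of_tendsto hlim
    (Filter.mem_of_superset (Ioo_mem_nhdsGT one_pos) hdiv)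

/-- The descent lemma on a convex set. -/
lemma le_add_inner_add_of_lipschitz_gradient {h : E → ℝ} {h' : E → E} {L : ℝ} {S : Set E}
    (hS : Convex ℝ S) (hgrad : ∀ x ∈ S, HasGradientAt h (h' x) x)
    (hlip : ∀ x ∈ S, ∀ y ∈ S, ‖h' x - h' y‖ ≤ L * ‖x - y‖)
    {x y : E} (hx : x ∈ S) (hy : y ∈ S) :
    h y ≤ h x + ⟪h' x, y - x⟫ + L / 2 * ‖y - x‖ ^ 2 := by
  have hmem : ∀ t ∈ Icc (0 : ℝ) 1, x + t • (y - x) ∈ S := fun t ht =>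
    hS.add_smul_sub_mem hx hy ht
  have hder : ∀ t ∈ Icc (0 : ℝ) 1, HasDerivAt
      (fun s : ℝ => h (x + s • (y - x)) - s * ⟪h' x, y - x⟫ - L / 2 * ‖y - x‖ ^ 2 * s ^ 2)
      (⟪h' (x + t • (y - x)), y - x⟫ - ⟪h' x, y - x⟫ - L * ‖y - x‖ ^ 2 * t) t := by
    intro t ht
    have hline : HasDerivAt (fun s : ℝ => x + s • (y - x)) (y - x) t := by
      simpa using ((hasDerivAt_id t).smul_const (y - x)).const_add x
    have h1 := (hgrad _ (hmem t ht)).hasFDerivAt.comp_hasDerivAt t hline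
    have h2 := (h1.sub ((hasDerivAt_id t).mul_const ⟪h' x, y - x⟫)).sub
      (((hasDerivAt_id t).pow 2).const_mul (L / 2 * ‖y - x‖ ^ 2))
    refine h2.congr_deriv ?_
    simp only [InnerProductSpace.toDual_apply_apply, id]
    push_cast
    ring
  have hanti := antitoneOn_of_deriv_nonpos (convex_Icc (0 : ℝ) 1)
    (fun t ht => (hder t ht).continuousAt.continuousWithinAt)
    (fun t ht => (hder t (interior_subset ht)).differentiableAt.differentiableWithinAt)
    (by
      intro t ht
      have ht' := interior_subset ht
      rw [(hder t ht').deriv, ← inner_sub_left]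
      have h1 := real_inner_le_norm (h' (x + t • (y - x)) - h' x) (y - x)
      have h2 := hlip _ (hmem t ht') x hx
      rw [add_sub_cancel_left, norm_smul, Real.norm_eq_abs, abs_of_nonneg ht'.1] at h2
      have h3 := mul_le_mul_of_nonneg_right h2 (norm_nonneg (y - x))
      linarith)
  have h01 := hanti (left_mem_Icc.2 zero_le_one) (right_mem_Icc.2 zero_le_one) zero_le_one
  simp only [one_smul, zero_smul, add_zero, add_sub_cancel] at h01
  linarith

lemma nonneg_of_lipschitz_on_open {V W : Type*} [NormedAddCommGroup V] [NormedSpace ℝ V]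
    [Nontrivial V] [NormedAddCommGroup W] {φ : V → W} {L : ℝ} {O : Set V} (hO : IsOpen O)
    (hne : O.Nonempty) (hlip : ∀ x ∈ O, ∀ y ∈ O, ‖φ x - φ y‖ ≤ L * ‖x - y‖) : 0 ≤ L := by
  obtain ⟨x, hx⟩ := hne
  have := Module.punctured_nhds_neBot ℝ V x
  obtain ⟨a, ha, b, hb, hab⟩ := (infinite_of_mem_nhds x (hO.mem_nhds hx)).nontrivial
  exact nonneg_of_mul_nonneg_left ((norm_nonneg _).trans (hlip a ha b hb))
    (norm_pos_iff.2 (sub_ne_zero.2 hab))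

lemma conj_segment_le {g : F → EReal} (hg : ProperFn g) {a b : F} {pa pb t : ℝ}
    (ha : conj g a = pa) (hb : conj g b = pb) (ht : t ∈ Ioo (0 : ℝ) 1) :
    conj g ((1 - t) • a + t • b) ≤ (((1 - t) * pa + t * pb : ℝ) : EReal) := by
  refine iSup_le fun w => ?_
  have h1 : ((⟪a, w⟫ : ℝ) : EReal) - g w ≤ pa :=
    ha ▸ le_iSup (fun w => ((⟪a, w⟫ : ℝ) : EReal) - g w) w
  have h2 : ((⟪b, w⟫ : ℝ) : EReal) - g w ≤ pb :=
    hb ▸ le_iSup (fun w => ((⟪b, w⟫ : ℝ) : EReal) - g w) w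
  have hbot := hg.1 w
  induction hw : g w with
  | bot => exact absurd hw hbot
  | top => simp
  | coe r =>
    rw [hw] at h1 h2
    norm_cast at h1 h2 ⊢
    rw [inner_add_left, inner_smul_left, inner_smul_left]
    simp only [conj_trivial]
    nlinarith [mul_le_mul_of_nonneg_left h1 (sub_nonneg.2 ht.2.le),
      mul_le_mul_of_nonneg_left h2 ht.1.le]

/-- Quadratic growth of the proximal objective of `conj g` at its minimizer. -/
lemma conj_prox_growth {g : F → EReal} (hg : ProperFn g) {γ : ℝ} {a b v : F} {pa pb : ℝ}
    (ha : conj g a = pa) (hb : conj g b = pb)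
    (hmin : ∀ ζ : F, conj g a + ((-⟪a, v⟫ + γ / 2 * ‖a‖ ^ 2 : ℝ) : EReal)
      ≤ conj g ζ + ((-⟪ζ, v⟫ + γ / 2 * ‖ζ‖ ^ 2 : ℝ) : EReal)) :
    pa - ⟪a, v⟫ + γ / 2 * ‖a‖ ^ 2 + γ / 2 * ‖b - a‖ ^ 2 ≤ pb - ⟪b, v⟫ + γ / 2 * ‖b‖ ^ 2 := by
  have := quadratic_growth_of_le_segment (pa := pa - ⟪a, v⟫) (pb := pb - ⟪b, v⟫) (κ := γ)
    (w := 0) (a := a) (b := b) (by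
      intro t ht
      have h1 := (hmin ((1 - t) • a + t • b)).trans
        (add_le_add_left (conj_segment_le hg ha hb ht) _)
      rw [ha] at h1
      norm_cast at h1
      rw [inner_add_left, inner_smul_left, inner_smul_left] at h1
      simp only [conj_trivial] at h1
      simp only [sub_zero]
      linarith)
  simpa only [sub_zero] using this

lemma conj_le_of_mem_subdiff {f : G → EReal} (hf : ProperFn f) {v w : G} {r : ℝ}
    (hw : f w = r) (hv : v ∈ subdiff f w) : conj f v ≤ ((⟪v, w⟫ - r : ℝ) : EReal) := by
  refine iSup_le fun q => ?_
  have h1 := hv.2 q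
  have hbot := hf.1 q
  induction hq : f q with
  | bot => exact absurd hq hbot
  | top => simp
  | coe s =>
    rw [hw, hq] at h1
    norm_cast at h1 ⊢
    rw [inner_sub_right] at h1
    linarith

lemma inner_le_of_strong_monotone {B : E →L[ℝ] F} {γ : ℝ} (hγ : 0 < γ) {d : F} {e : E}
    (hd : γ * ‖d‖ ^ 2 ≤ ⟪d, B e⟫) : ⟪d, B e⟫ ≤ ‖B‖ ^ 2 / γ * ‖e‖ ^ 2 := by
  have h1 : ⟪d, B e⟫ ≤ ‖d‖ * (‖B‖ * ‖e‖) :=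
    (real_inner_le_norm _ _).trans (mul_le_mul_of_nonneg_left (B.le_opNorm e) (norm_nonneg d))
  have h2 : ‖B‖ ^ 2 / γ * ‖e‖ ^ 2 = (‖B‖ * ‖e‖) ^ 2 / γ := by ring
  rw [h2, le_div_iff₀ hγ]
  nlinarith [sq_nonneg (γ * ‖d‖ - ‖B‖ * ‖e‖), mul_le_mul_of_nonneg_left hd hγ.le,
    mul_le_mul_of_nonneg_left h1 hγ.le]

lemma psi_eq_coe {S : Set E} {g : F → EReal} {h : E → ℝ} {A : E →L[ℝ] F} {δ γ : ℝ} {x u : E}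
    {z : F} {p : ℝ} (hx : x ∈ S) (hp : conj g z = p) :
    psi S g h A δ γ x z u =
      ((⟪z, A x⟫ + h x + δ / 2 * ‖x - u‖ ^ 2 - γ / 2 * ‖z‖ ^ 2 - p : ℝ) : EReal) := by
  simp only [psi, indicatorFn, if_pos hx, add_zero, hp]
  norm_cast

/-- A decrease of the numerator relative to `θ` times the new
denominator yields a decrease of the quotient. -/
lemma div_le_div_sub_of_le {P P' D D' Q M θ φ c R : ℝ} (hθ : 0 < θ) (hD : 0 < D) (hDφ : D ≤ φ)
    (hP : P = θ * φ) (hD' : 0 < D') (hD'M : D' ≤ M) (hcR : 0 ≤ c * R)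
    (hQ : P' ≤ θ * D' - Q) (hMQ : M * (c * R) ≤ Q) : P' / D' ≤ P / D - c * R := by
  have h1 : P' / D' ≤ θ - c * R := by
    rw [div_le_iff₀ hD']
    nlinarith [mul_le_mul_of_nonneg_right hD'M hcR]
  have h2 : θ ≤ P / D := by
    rw [le_div_iff₀ hD, hP]
    exact mul_le_mul_of_nonneg_left hDφ hθ.le
  linarith

/-- sufficient decrease of the merit function `Γ`. -/
theorem gamma_sufficient_decrease
    (S : Set E) (g : F → EReal) (h : E → ℝ) (h' : E → E) (Lh : ℝ)
    (f : G → EReal) (A : E →L[ℝ] F) (K : E →L[ℝ] G)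
    (hA1 : Assumption1 S g h h' Lh f A K) (hA2 : Assumption2 S g A)
    (γ ν β δ : ℝ) (hγ : 0 < γ) (hν : 0 < ν) (hβ : β ∈ Ioo (0 : ℝ) 2)
    (hδ : δ = 2 * ν + Lh + 2 * ‖A‖ ^ 2 / γ)
    (x u : ℕ → E) (y : ℕ → G) (z : ℕ → F) (θ : ℕ → ℝ)
    (halg : IsAlgoSeq S g h h' f A K γ δ β x u y z θ)
    (m M : ℝ) (hm : 0 < m)
    (hbound : ∀ x' ∈ S, (m : EReal) ≤ f (K x') ∧ f (K x') ≤ (M : EReal))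
    (K₁ : ℕ)
    (hK₁ : ∀ k ≥ K₁,
      (m : EReal) ≤ ((⟪K (x k), y k⟫ : ℝ) : EReal) - conj f (y k) ∧
      ((⟪K (x k), y k⟫ : ℝ) : EReal) - conj f (y k) ≤ f (K (x k)) ∧
      f (K (x k)) ≤ (M : EReal))
    (c : ℝ) (hc : c = min (min ν (δ * (2 - β) / (2 * β))) (γ / 2) / M) :
    ∀ k ≥ K₁,
      gamPt S g h f A K δ γ (x (k + 1)) (y (k + 1)) (z (k + 1)) (u (k + 1))
        ≤ gamPt S g h f A K δ γ (x k) (y k) (z k) (u k)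
          - ((c * ‖x k - x (k + 1)‖ ^ 2 + c * ‖u k - u (k + 1)‖ ^ 2
              + c * ‖z k - z (k + 1)‖ ^ 2 : ℝ) : EReal) := by
  obtain ⟨-, hSc, -, hgp, -, -, ⟨O, hO, hSO, hgrad, hlip⟩, hfp, -⟩ := hA1
  obtain ⟨hx0, hz, hθ, hy, hx, hu⟩ := halg
  have hxS : ∀ k, x k ∈ S := fun k => by
    cases k with
    | zero => exact hx0
    | succ k => exact (hx k).1
  have hφ : ∀ k, ∃ φ : ℝ, f (K (x k)) = φ := fun k => by
    obtain ⟨h1, h2⟩ := hbound _ (hxS k)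
    induction hq : f (K (x k)) with
    | bot => simp [hq] at h1
    | top => simp [hq] at h2
    | coe r => exact ⟨r, rfl⟩
  have hp : ∀ k, ∃ p : ℝ, conj g (z k) = p := fun k => by
    obtain ⟨φ, hφk⟩ := hφ k
    have h1 := (hθ k).2
    rw [hφk, psi, indicatorFn, if_pos (hxS k), add_zero, ← EReal.coe_mul] at h1
    induction hq : conj g (z k) with
    | bot => rw [hq, EReal.coe_sub_bot] at h1; exact absurd h1 (EReal.coe_ne_top _)
    | top => rw [hq, EReal.sub_top] at h1; exact absurd h1 (EReal.coe_ne_bot _)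
    | coe r => exact ⟨r, rfl⟩
  choose φ hφ using hφ
  choose p hp using hp
  have hq : ∀ k ≥ K₁, ∃ q : ℝ, conj f (y k) = q := fun k hk => by
    obtain ⟨h1, h2, -⟩ := hK₁ k hk
    rw [hφ] at h2
    induction hq : conj f (y k) with
    | bot => rw [hq, EReal.coe_sub_bot] at h2; simp at h2
    | top => rw [hq, EReal.sub_top] at h1; simp at h1
    | coe r => exact ⟨r, rfl⟩
  intro k hk
  obtain ⟨q, hqk⟩ := hq k hk
  obtain ⟨q', hqk'⟩ := hq (k + 1) (hk.trans k.le_succ)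
  obtain ⟨hD, hDφ, -⟩ := hK₁ k hk
  obtain ⟨hD', hDφ', hφM'⟩ := hK₁ (k + 1) (hk.trans k.le_succ)
  have hψ := (hθ k).2
  rw [psi_eq_coe (hxS k) (hp k), hφ k] at hψ
  have hfen := conj_le_of_mem_subdiff hfp (hφ k) (hy k)
  rw [gamPt, gamPt, psi_eq_coe (hxS k) (hp k), psi_eq_coe (hxS (k + 1)) (hp (k + 1)), hqk, hqk']
  rw [hqk, hφ] at hDφ
  rw [hqk', hφ] at hDφ'
  rw [hqk] at hD
  rw [hqk'] at hD' hfen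
  rw [hφ] at hφM'
  simp only [← EReal.coe_sub, ← EReal.coe_div, ← EReal.coe_mul, EReal.coe_le_coe_iff,
    EReal.coe_eq_coe_iff] at hD hDφ hD' hDφ' hφM' hψ hfen ⊢
  have hM : 0 < M := by linarith
  have hz1 := conj_prox_growth hgp (hp k) (hp (k + 1)) (hz k)
  have hz2 := conj_prox_growth hgp (hp (k + 1)) (hp k) (hz (k + 1))
  have hmono : γ * ‖z (k + 1) - z k‖ ^ 2 ≤
      ⟪z (k + 1) - z k, A (x (k + 1) - x k)⟫ := by
    rw [norm_sub_rev (z k)] at hz2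
    rw [map_sub, inner_sub_left, inner_sub_right, inner_sub_right]
    linarith
  have hzx := inner_le_of_strong_monotone hγ hmono
  have hdesc := le_add_inner_add_of_lipschitz_gradient hSc (fun w hw => hgrad w (hSO hw))
    (fun v hv w hw => hlip v (hSO hv) w (hSO hw)) (hxS k) (hxS (k + 1))
  have hxg := quadratic_growth_of_le_segment (κ := δ) (w := u k) (a := x (k + 1)) (b := x k)
    (pa := ⟪z k, A (x (k + 1))⟫ - θ k * ⟪K (x (k + 1)), y (k + 1)⟫ + ⟪h' (x k), x (k + 1)⟫)
    (pb := ⟪z k, A (x k)⟫ - θ k * ⟪K (x k), y (k + 1)⟫ + ⟪h' (x k), x k⟫) (by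
      intro t ht
      refine ((hx k).2 _ (hSc (hxS (k + 1)) (hxS k) (sub_nonneg.2 ht.2.le) ht.1.le
        (by ring))).trans_eq ?_
      simp only [map_add, map_smul, inner_add_left, inner_add_right, real_inner_smul_left,
        real_inner_smul_right]
      ring)
  have hβ0 : β ≠ 0 := hβ.1.ne'
  have hu1 : ‖x (k + 1) - u (k + 1)‖ ^ 2 = (1 - β) ^ 2 * ‖x (k + 1) - u k‖ ^ 2 := by
    have : x (k + 1) - u (k + 1) = (1 - β) • (x (k + 1) - u k) := by rw [hu]; module
    rw [this, norm_smul, mul_pow, Real.norm_eq_abs, sq_abs]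
  have hu2 : ‖u k - u (k + 1)‖ ^ 2 = β ^ 2 * ‖x (k + 1) - u k‖ ^ 2 := by
    have : u k - u (k + 1) = (-β) • (x (k + 1) - u k) := by rw [hu]; module
    rw [this, norm_smul, mul_pow, Real.norm_eq_abs, sq_abs, neg_sq]
  have hu3 : δ * (2 - β) / (2 * β) * ‖u k - u (k + 1)‖ ^ 2 =
      δ / 2 * ‖x (k + 1) - u k‖ ^ 2 - δ / 2 * ‖x (k + 1) - u (k + 1)‖ ^ 2 := by
    rw [hu1, hu2]
    field_simp
    ring
  have hcM : M * c = min (min ν (δ * (2 - β) / (2 * β))) (γ / 2) := by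
    rw [hc]; field_simp
  have hR : 0 ≤ c * (‖x k - x (k + 1)‖ ^ 2 + ‖u k - u (k + 1)‖ ^ 2
      + ‖z k - z (k + 1)‖ ^ 2) := by
    cases subsingleton_or_nontrivial E with
    | inl hE =>
      have hxx : x (k + 1) - x k = 0 := Subsingleton.elim _ _
      have hzz : ‖z (k + 1) - z k‖ ^ 2 ≤ 0 := by
        rw [hxx, map_zero, inner_zero_right] at hmono
        exact nonpos_of_mul_nonpos_right hmono hγ
      have hzz' : ‖z k - z (k + 1)‖ ^ 2 = 0 := by
        rw [norm_sub_rev]; exact le_antisymm hzz (sq_nonneg _)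
      rw [hzz', Subsingleton.elim (x k) (x (k + 1)), Subsingleton.elim (u k) (u (k + 1))]
      simp
    | inr hE =>
      have hL := nonneg_of_lipschitz_on_open hO ⟨x 0, hSO hx0⟩ hlip
      have hδ0 : 0 < δ := by rw [hδ]; positivity
      have h2β : 0 < 2 - β := sub_pos.2 hβ.2
      have hβp : 0 < β := hβ.1
      have hc0 : 0 ≤ c := by rw [hc]; positivity
      positivity
  have hnx := norm_sub_rev (x k) (x (k + 1))
  have hnz := norm_sub_rev (z k) (z (k + 1))
  rw [← mul_add, ← mul_add]
  refine div_le_div_sub_of_le (θ := θ k) (φ := φ k) (M := M)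
    (Q := ν * ‖x k - x (k + 1)‖ ^ 2 + δ * (2 - β) / (2 * β) * ‖u k - u (k + 1)‖ ^ 2
      + γ / 2 * ‖z k - z (k + 1)‖ ^ 2) (hθ k).1 (hm.trans_le hD) hDφ hψ.symm
    (hm.trans_le hD') (hDφ'.trans hφM') hR ?_ ?_
  · have hθD := mul_le_mul_of_nonneg_left hfen (hθ k).1.le
    rw [hu3, hnx, hnz]
    have hδx : δ / 2 * ‖x (k + 1) - x k‖ ^ 2 = ν * ‖x (k + 1) - x k‖ ^ 2
        + Lh / 2 * ‖x (k + 1) - x k‖ ^ 2 + ‖A‖ ^ 2 / γ * ‖x (k + 1) - x k‖ ^ 2 := by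
      rw [hδ]; ring
    rw [hnx] at hxg
    rw [map_sub, inner_sub_left, inner_sub_right, inner_sub_right] at hzx
    rw [inner_sub_right] at hdesc
    rw [real_inner_comm] at hθD
    linarith
  · rw [← mul_assoc, hcM, mul_add, mul_add]
    gcongr
    · exact (min_le_left _ _).trans (min_le_left _ _)
    · exact (min_le_left _ _).trans (min_le_right _ _)
    · exact min_le_right _ _

end FracPaper
end
end

section
/- Suppose Assumptions 1 and 2 hold, let (x^k, y^k, z^k, u^k, θ_k)_{k≥0} be generated by the constant-parameter algorithm, and let K₁ be an index such that 0 < m ≤ ⟨Kx^k, y^k⟩ − f*(y^k) ≤ f(Kx^k) ≤ M for all k ≥ K₁. Then lim_{k→∞} Γ(x^k, y^k, z^k, u^k) exists and equals θ̄ := lim_{k→∞} θ_k; moreover, Γ(x̄, ȳ, z̄, ū) = θ̄ for every accumulation point (x̄, ȳ, z̄, ū) of the sequence (x^k, y^k, z^k, u^k). -/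
open Set Filter Topology Metric

open scoped RealInnerProductSpace

noncomputable section

namespace FracPaper

variable {E : Type*} [NormedAddCommGroup E] [InnerProductSpace ℝ E] [FiniteDimensional ℝ E]
variable {F : Type*} [NormedAddCommGroup F] [InnerProductSpace ℝ F] [FiniteDimensional ℝ F]
variable {G : Type*} [NormedAddCommGroup G] [InnerProductSpace ℝ G] [FiniteDimensional ℝ G]

set_option linter.unusedSectionVars false

lemma conj_le_coe_iff (g : E → EReal) (v : E) (c : ℝ) :
    conj g v ≤ (c : EReal) ↔ ∀ w, ((⟪v, w⟫ - c : ℝ) : EReal) ≤ g w := by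
  unfold conj
  rw [iSup_le_iff]
  refine forall_congr' fun w => ?_
  induction g w with
  | bot => simp [-EReal.coe_sub]
  | top => simp
  | coe r =>
    norm_cast
    constructor <;> intro h <;> linarith

lemma conj_convex_combination (g : E → EReal) {v w : E} {a b t : ℝ} (ht : 0 ≤ t) (ht' : t ≤ 1)
    (hv : conj g v ≤ (a : EReal)) (hw : conj g w ≤ (b : EReal)) :
    conj g ((1 - t) • v + t • w) ≤ (((1 - t) * a + t * b : ℝ) : EReal) := by
  rw [conj_le_coe_iff] at *
  intro x
  specialize hv x
  specialize hw x
  induction hg : g x with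
  | bot => simp [hg, -EReal.coe_sub] at hv
  | top => simp
  | coe r =>
    rw [hg] at hv hw
    norm_cast at *
    rw [inner_add_left, real_inner_smul_left, real_inner_smul_left]
    nlinarith

lemma conj_le_of_tendsto (g : E → EReal) {v : ℕ → E} {c : ℕ → ℝ} {v₀ : E} {c₀ : ℝ}
    (hv : Tendsto v atTop (𝓝 v₀)) (hc : Tendsto c atTop (𝓝 c₀))
    (h : ∀ᶠ k in atTop, conj g (v k) ≤ (c k : EReal)) : conj g v₀ ≤ (c₀ : EReal) := by
  rw [conj_le_coe_iff]
  intro w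
  have h1 : Tendsto (fun k => ((⟪v k, w⟫ - c k : ℝ) : EReal)) atTop
      (𝓝 ((⟪v₀, w⟫ - c₀ : ℝ) : EReal)) :=
    (continuous_coe_real_ereal.tendsto _).comp ((hv.inner tendsto_const_nhds).sub hc)
  refine le_of_tendsto h1 ?_
  filter_upwards [h] with k hk
  exact (conj_le_coe_iff g _ _).1 hk w

lemma conj_eq_of_mem_subdiff (f : E → EReal) {w v : E} {a : ℝ} (ha : f w = (a : EReal))
    (hv : v ∈ subdiff f w) : conj f v = ((⟪v, w⟫ - a : ℝ) : EReal) := by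
  apply le_antisymm
  · rw [conj_le_coe_iff]
    intro x
    refine le_trans (le_of_eq ?_) (hv.2 x)
    rw [ha, inner_sub_right]
    norm_cast
    ring
  · refine le_trans (le_of_eq ?_) (le_iSup _ w)
    rw [ha]
    norm_cast

lemma mem_subdiff_iff_of_eq_coe (f : E → EReal) {w v : E} {a : ℝ} (ha : f w = (a : EReal)) :
    v ∈ subdiff f w ↔ ∀ x, ((a + ⟪v, x - w⟫ : ℝ) : EReal) ≤ f x := by
  simp [subdiff, epsSubdiff, ha]

/-- A minimizer of a convex function plus a quadratic satisfies the quadratic growth estimate. -/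
lemma quadratic_growth_of_minimizer {a b c : ℝ} {p q : E}
    (h : ∀ t ∈ Ioo (0 : ℝ) 1,
      a + c / 2 * ‖p‖ ^ 2 ≤ (1 - t) * a + t * b + c / 2 * ‖(1 - t) • p + t • q‖ ^ 2) :
    a + c / 2 * ‖p‖ ^ 2 + c / 2 * ‖p - q‖ ^ 2 ≤ b + c / 2 * ‖q‖ ^ 2 := by
  have key : ∀ t ∈ Ioo (0 : ℝ) 1,
      a + c / 2 * ‖p‖ ^ 2 + (1 - t) * (c / 2 * ‖p - q‖ ^ 2) ≤ b + c / 2 * ‖q‖ ^ 2 := by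
    intro t ht
    have h1 := h t ht
    have h2 : ‖(1 - t) • p + t • q‖ ^ 2
        = (1 - t) * ‖p‖ ^ 2 + t * ‖q‖ ^ 2 - t * (1 - t) * ‖p - q‖ ^ 2 := by
      rw [norm_add_sq_real, norm_sub_sq_real, norm_smul, norm_smul, real_inner_smul_left,
        real_inner_smul_right, mul_pow, mul_pow, Real.norm_eq_abs, Real.norm_eq_abs, sq_abs, sq_abs]
      ring
    rw [h2] at h1
    refine le_of_mul_le_mul_left ?_ ht.1
    linarith
  have hlim : Tendsto (fun t : ℝ => a + c / 2 * ‖p‖ ^ 2 + (1 - t) * (c / 2 * ‖p - q‖ ^ 2))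
      (𝓝[>] 0) (𝓝 (a + c / 2 * ‖p‖ ^ 2 + (1 - 0) * (c / 2 * ‖p - q‖ ^ 2))) :=
    Continuous.tendsto (by fun_prop) 0 |>.mono_left nhdsWithin_le_nhds
  have := le_of_tendsto hlim (by
    filter_upwards [Ioo_mem_nhdsGT (show (0 : ℝ) < 1 by norm_num)] with t ht using key t ht)
  simpa using this

/-- The descent lemma for functions with Lipschitz gradient. -/
lemma le_quadratic_of_lipschitz_gradient {S : Set E} (hS : Convex ℝ S) {h : E → ℝ} {h' : E → E}
    {L : ℝ} (hgrad : ∀ x ∈ S, HasGradientAt h (h' x) x)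
    (hlip : ∀ x ∈ S, ∀ y ∈ S, ‖h' x - h' y‖ ≤ L * ‖x - y‖) {x y : E} (hx : x ∈ S) (hy : y ∈ S) :
    h y ≤ h x + ⟪h' x, y - x⟫ + L / 2 * ‖y - x‖ ^ 2 := by
  set d := y - x with hd
  have hmem : ∀ t ∈ Icc (0 : ℝ) 1, x + t • d ∈ S := fun t ht => hS.add_smul_sub_mem hx hy ht
  have hderiv : ∀ t ∈ Icc (0 : ℝ) 1,
      HasDerivAt (fun t : ℝ => h (x + t • d)) ⟪h' (x + t • d), d⟫ t := by
    intro t ht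
    have h1 : HasDerivAt (fun t : ℝ => x + t • d) d t := by
      simpa using ((hasDerivAt_id t).smul_const d).const_add x
    have h2 := (hgrad _ (hmem t ht)).hasFDerivAt.comp_hasDerivAt t h1
    rw [InnerProductSpace.toDual_apply_apply] at h2
    exact h2
  have hB : ∀ t : ℝ, HasDerivAt (fun t : ℝ => h x + t * ⟪h' x, d⟫ + L / 2 * ‖d‖ ^ 2 * t ^ 2)
      (⟪h' x, d⟫ + L * ‖d‖ ^ 2 * t) t := by
    intro t
    have h1 := (((hasDerivAt_id t).mul_const ⟪h' x, d⟫).const_add (h x)).add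
      ((hasDerivAt_pow 2 t).const_mul (L / 2 * ‖d‖ ^ 2))
    refine h1.congr_deriv ?_
    norm_num
    ring
  have key := image_le_of_deriv_right_le_deriv_boundary
    (fun t ht => (hderiv t ht).continuousAt.continuousWithinAt)
    (fun t ht => (hderiv t (Ico_subset_Icc_self ht)).hasDerivWithinAt)
    (by simp)
    (fun t _ => (hB t).continuousAt.continuousWithinAt)
    (fun t _ => (hB t).hasDerivWithinAt) (by
      intro t ht
      have h1 := hlip _ (hmem t (Ico_subset_Icc_self ht)) x hx
      have h2 := real_inner_le_norm (h' (x + t • d) - h' x) d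
      rw [inner_sub_left] at h2
      rw [add_sub_cancel_left, norm_smul, Real.norm_of_nonneg ht.1] at h1
      nlinarith [norm_nonneg d]) (right_mem_Icc.2 zero_le_one)
  simpa [hd] using key

lemma convexOn_toReal_interior_edom {f : E → EReal} (hproper : ProperFn f) (hconv : ConvexFn f) :
    ConvexOn ℝ (interior (edom f)) fun w => (f w).toReal := by
  have hle : ∀ x ∈ edom f, ∀ y ∈ edom f, ∀ a b : ℝ, 0 ≤ a → 0 ≤ b → a + b = 1 →
      f (a • x + b • y) ≤ ((a * (f x).toReal + b * (f y).toReal : ℝ) : EReal) := by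
    intro x hx y hy a b ha hb hab
    refine (hconv x y a b ha hb hab).trans (le_of_eq ?_)
    rw [EReal.coe_add, EReal.coe_mul, EReal.coe_mul, EReal.coe_toReal hx (hproper.1 x),
      EReal.coe_toReal hy (hproper.1 y)]
  have hcv : Convex ℝ (edom f) := fun x hx y hy a b ha hb hab =>
    ((hle x hx y hy a b ha hb hab).trans_lt (EReal.coe_lt_top _)).ne
  refine ⟨hcv.interior, fun x hx y hy a b ha hb hab => ?_⟩
  have h1 := hle x (interior_subset hx) y (interior_subset hy) a b ha hb hab
  exact EReal.toReal_le_toReal h1 (hproper.1 _) (EReal.coe_ne_top _)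

/-- Subgradients of a nonnegative function over a compact subset of the interior of the domain are
bounded. -/
lemma exists_norm_le_of_mem_subdiff {f : E → EReal} (hproper : ProperFn f) (hconv : ConvexFn f)
    {C : Set E} (hC : IsCompact C) (hCf : C ⊆ interior (edom f)) (hnonneg : ∀ w ∈ C, 0 ≤ f w) :
    ∃ B : ℝ, ∀ w ∈ C, ∀ v ∈ subdiff f w, ‖v‖ ≤ B := by
  obtain ⟨r, hr, hrC⟩ := hC.exists_cthickening_subset_open isOpen_interior hCf
  have hcont := (convexOn_toReal_interior_edom hproper hconv).continuousOn isOpen_interior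
  obtain ⟨B, hB⟩ := (hC.cthickening (r := r)).bddAbove_image (hcont.mono hrC)
  refine ⟨max 0 (B / r), fun w hw v hv => ?_⟩
  rcases eq_or_ne v 0 with rfl | hv0
  · simp
  have hn : 0 < ‖v‖ := norm_pos_iff.2 hv0
  set w' := w + (r / ‖v‖) • v with hw'
  have hw'mem : w' ∈ cthickening r C := by
    refine mem_cthickening_of_dist_le w' w r C hw ?_
    rw [hw', dist_eq_norm, add_sub_cancel_left, norm_smul, norm_div, norm_norm,
      Real.norm_of_nonneg hr.le]
    exact (div_mul_cancel₀ _ hn.ne').le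
  have h1 := hv.2 w'
  have h2 : ⟪v, w' - w⟫ = r * ‖v‖ := by
    rw [hw', add_sub_cancel_left, real_inner_smul_right, real_inner_self_eq_norm_sq]
    field_simp
  have h3 : f w' = ((f w').toReal : EReal) :=
    (EReal.coe_toReal (interior_subset (hrC hw'mem)) (hproper.1 _)).symm
  have h4 : ((r * ‖v‖ : ℝ) : EReal) ≤ ((f w').toReal : EReal) := by
    rw [← h3]
    refine le_trans ?_ h1
    rw [h2, sub_zero]
    exact le_add_of_nonneg_left (hnonneg w hw)
  have h5 : r * ‖v‖ ≤ B := (EReal.coe_le_coe_iff.1 h4).trans (hB (mem_image_of_mem _ hw'mem))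
  refine le_max_of_le_right ?_
  rw [le_div_iff₀ hr]
  linarith

lemma psi_eq_coe_iff {S : Set E} {g : F → EReal} {h : E → ℝ} {A : E →L[ℝ] F} {δ γ : ℝ}
    {x u : E} {z : F} (hx : x ∈ S) {c : ℝ} :
    psi S g h A δ γ x z u = (c : EReal) ↔
      conj g z = ((⟪z, A x⟫ + h x + δ / 2 * ‖x - u‖ ^ 2 - γ / 2 * ‖z‖ ^ 2 - c : ℝ) : EReal) := by
  simp only [psi, indicatorFn, hx, if_true, add_zero]
  generalize ⟪z, A x⟫ + h x + δ / 2 * ‖x - u‖ ^ 2 - γ / 2 * ‖z‖ ^ 2 = r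
  induction conj g z with
  | bot => simp [-EReal.coe_sub]
  | top => simp [-EReal.coe_sub, eq_comm]
  | coe s =>
    norm_cast
    constructor <;> intro h <;> linarith

/-- Sufficient decrease of one step of the algorithm. -/
lemma IsAlgoSeq.sufficient_decrease {S : Set E} {g : F → EReal} {h : E → ℝ} {h' : E → E}
    {f : G → EReal} {A : E →L[ℝ] F} {K : E →L[ℝ] G} {γ δ β Lh ν : ℝ}
    {x u : ℕ → E} {y : ℕ → G} {z : ℕ → F} {θ : ℕ → ℝ}
    (halg : IsAlgoSeq S g h h' f A K γ δ β x u y z θ) (hS : Convex ℝ S)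
    (hgrad : ∀ x ∈ S, HasGradientAt h (h' x) x)
    (hlip : ∀ x ∈ S, ∀ y ∈ S, ‖h' x - h' y‖ ≤ Lh * ‖x - y‖)
    (hγ : 0 < γ) (hν : 0 < ν) (hLh : 0 ≤ Lh) (hβ : β ∈ Ioo (0 : ℝ) 2)
    (hδ : δ = 2 * ν + Lh + 2 * ‖A‖ ^ 2 / γ)
    (hxS : ∀ k, x k ∈ S) {fK : ℕ → ℝ} (hfK : ∀ k, f (K (x k)) = (fK k : EReal)) (k : ℕ) :
    ν * ‖x (k + 1) - x k‖ ^ 2 ≤ (θ k - θ (k + 1)) * fK (k + 1) := by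
  obtain ⟨-, hz, hθ, hy, hxmin, hu⟩ := halg
  have hconj : ∀ j, conj g (z j) = ((⟪z j, A (x j)⟫ + h (x j) + δ / 2 * ‖x j - u j‖ ^ 2
      - γ / 2 * ‖z j‖ ^ 2 - θ j * fK j : ℝ) : EReal) := by
    intro j
    rw [← psi_eq_coe_iff (hxS j), ← (hθ j).2, hfK, EReal.coe_mul]
  obtain ⟨c, hc⟩ : ∃ c : ℕ → ℝ, ∀ j, c j = ⟪z j, A (x j)⟫ + h (x j) + δ / 2 * ‖x j - u j‖ ^ 2
      - γ / 2 * ‖z j‖ ^ 2 - θ j * fK j := ⟨_, fun _ => rfl⟩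
  simp only [← hc] at hconj
  have hprox : (c k - ⟪z k, A (x k)⟫) + γ / 2 * ‖z k‖ ^ 2 + γ / 2 * ‖z k - z (k + 1)‖ ^ 2
      ≤ (c (k + 1) - ⟪z (k + 1), A (x k)⟫) + γ / 2 * ‖z (k + 1)‖ ^ 2 := by
    refine quadratic_growth_of_minimizer fun t ht => ?_
    have h1 := (hz k ((1 - t) • z k + t • z (k + 1))).trans (add_le_add_left
      (conj_convex_combination g ht.1.le ht.2.le (hconj k).le (hconj (k + 1)).le) _)
    rw [hconj] at h1
    norm_cast at h1
    rw [inner_add_left, real_inner_smul_left, real_inner_smul_left] at h1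
    linarith
  have hx : (⟪z k, A (x (k + 1))⟫ - θ k * ⟪K (x (k + 1)), y (k + 1)⟫ + ⟪h' (x k), x (k + 1)⟫)
        + δ / 2 * ‖x (k + 1) - u k‖ ^ 2 + δ / 2 * ‖(x (k + 1) - u k) - (x k - u k)‖ ^ 2
      ≤ (⟪z k, A (x k)⟫ - θ k * ⟪K (x k), y (k + 1)⟫ + ⟪h' (x k), x k⟫)
        + δ / 2 * ‖x k - u k‖ ^ 2 := by
    refine quadratic_growth_of_minimizer fun t ht => ?_
    have h1 := (hxmin k).2 ((1 - t) • x (k + 1) + t • x k)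
      (hS (hxS (k + 1)) (hxS k) (sub_nonneg.2 ht.2.le) ht.1.le (by ring))
    have h2 : (1 - t) • x (k + 1) + t • x k - u k
        = (1 - t) • (x (k + 1) - u k) + t • (x k - u k) := by module
    rw [h2] at h1
    simp only [map_add, map_smul, inner_add_left, inner_add_right, real_inner_smul_left,
      real_inner_smul_right] at h1
    linarith
  rw [sub_sub_sub_cancel_right] at hx
  have hh := le_quadratic_of_lipschitz_gradient hS hgrad hlip (hxS k) (hxS (k + 1))
  have hf : fK k + ⟪y (k + 1), K (x (k + 1)) - K (x k)⟫ ≤ fK (k + 1) := by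
    have h1 := (mem_subdiff_iff_of_eq_coe f (hfK k)).1 (hy k) (K (x (k + 1)))
    rw [hfK] at h1
    exact_mod_cast h1
  have hθf := mul_le_mul_of_nonneg_left hf (hθ k).1.le
  have hunorm : ‖x (k + 1) - u (k + 1)‖ ^ 2 = (1 - β) ^ 2 * ‖x (k + 1) - u k‖ ^ 2 := by
    have h1 : x (k + 1) - u (k + 1) = (1 - β) • (x (k + 1) - u k) := by rw [hu]; module
    rw [h1, norm_smul, mul_pow, Real.norm_eq_abs, sq_abs]
  have hyoung : ⟪z (k + 1) - z k, A (x (k + 1) - x k)⟫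
      ≤ γ / 2 * ‖z k - z (k + 1)‖ ^ 2 + ‖A‖ ^ 2 / γ * ‖x (k + 1) - x k‖ ^ 2 := by
    have h1 := real_inner_le_norm (z (k + 1) - z k) (A (x (k + 1) - x k))
    have h2 := A.le_opNorm (x (k + 1) - x k)
    have h3 := h1.trans (mul_le_mul_of_nonneg_left h2 (norm_nonneg _))
    rw [norm_sub_rev (z k)]
    set p := ‖z (k + 1) - z k‖
    set q := ‖A‖ * ‖x (k + 1) - x k‖ with hq
    have h4 : ‖A‖ ^ 2 / γ * ‖x (k + 1) - x k‖ ^ 2 = q ^ 2 / γ := by rw [hq]; ring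
    have h5 : γ / 2 * p ^ 2 + q ^ 2 / γ - p * q = ((γ * p - q) ^ 2 + q ^ 2) / (2 * γ) := by
      field_simp
      ring
    have h6 : 0 ≤ ((γ * p - q) ^ 2 + q ^ 2) / (2 * γ) := by positivity
    rw [h4]
    linarith
  have hδ0 : 0 ≤ δ := by rw [hδ]; positivity
  have hβ' : 0 ≤ δ / 2 * ((1 - (1 - β) ^ 2) * ‖x (k + 1) - u k‖ ^ 2) := by
    have : 0 ≤ 1 - (1 - β) ^ 2 := by nlinarith [hβ.1, hβ.2]
    positivity
  have hδd : δ / 2 * ‖x (k + 1) - x k‖ ^ 2 = ν * ‖x (k + 1) - x k‖ ^ 2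
      + Lh / 2 * ‖x (k + 1) - x k‖ ^ 2 + ‖A‖ ^ 2 / γ * ‖x (k + 1) - x k‖ ^ 2 := by
    rw [hδ]; ring
  have hc0 := hc k
  have hc1 := hc (k + 1)
  rw [hunorm] at hc1
  simp only [map_sub, inner_sub_left, inner_sub_right] at *
  rw [real_inner_comm (y (k + 1)) (K (x (k + 1))), real_inner_comm (y (k + 1)) (K (x k))] at hx
  linarith

lemma gamPt_eq_coe_div {S : Set E} {g : F → EReal} {h : E → ℝ} {f : G → EReal}
    {A : E →L[ℝ] F} {K : E →L[ℝ] G} {δ γ : ℝ} {x u : E} {y : G} {z : F} {p d : ℝ}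
    (hp : psi S g h A δ γ x z u = (p : EReal))
    (hd : ((⟪K x, y⟫ : ℝ) : EReal) - conj f y = (d : EReal)) :
    gamPt S g h f A K δ γ x y z u = ((p / d : ℝ) : EReal) := by
  rw [gamPt, hp, hd, EReal.coe_div]

/-- the merit function `Γ` converges along the iterates to `θ̄`, and
takes the value `θ̄` at every accumulation point. -/
theorem gamma_limit_eq_thetabar
    (S : Set E) (g : F → EReal) (h : E → ℝ) (h' : E → E) (Lh : ℝ)
    (f : G → EReal) (A : E →L[ℝ] F) (K : E →L[ℝ] G)
    (hA1 : Assumption1 S g h h' Lh f A K) (hA2 : Assumption2 S g A)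
    (γ ν β δ : ℝ) (hγ : 0 < γ) (hν : 0 < ν) (hβ : β ∈ Ioo (0 : ℝ) 2)
    (hδ : δ = 2 * ν + Lh + 2 * ‖A‖ ^ 2 / γ)
    (x u : ℕ → E) (y : ℕ → G) (z : ℕ → F) (θ : ℕ → ℝ)
    (halg : IsAlgoSeq S g h h' f A K γ δ β x u y z θ)
    (m M : ℝ) (hm : 0 < m)
    (hbound : ∀ x' ∈ S, (m : EReal) ≤ f (K x') ∧ f (K x') ≤ (M : EReal))
    (K₁ : ℕ)
    (hK₁ : ∀ k ≥ K₁,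
      (m : EReal) ≤ ((⟪K (x k), y k⟫ : ℝ) : EReal) - conj f (y k) ∧
      ((⟪K (x k), y k⟫ : ℝ) : EReal) - conj f (y k) ≤ f (K (x k)) ∧
      f (K (x k)) ≤ (M : EReal))
    (θbar : ℝ) (hθbar : Tendsto θ atTop (nhds θbar)) :
    Tendsto (fun k => gamPt S g h f A K δ γ (x k) (y k) (z k) (u k)) atTop
        (nhds ((θbar : ℝ) : EReal)) ∧
    ∀ (xb : E) (yb : G) (zb : F) (ub : E) (φ : ℕ → ℕ), StrictMono φ →
      Tendsto (fun j => x (φ j)) atTop (nhds xb) →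
      Tendsto (fun j => y (φ j)) atTop (nhds yb) →
      Tendsto (fun j => z (φ j)) atTop (nhds zb) →
      Tendsto (fun j => u (φ j)) atTop (nhds ub) →
      gamPt S g h f A K δ γ xb yb zb ub = ((θbar : ℝ) : EReal) := by
  obtain ⟨-, hSconv, hScomp, hgp, -, -, ⟨O, -, hSO, hgrad, hlip⟩, hfp, hfc, -, hKint, -, -, -⟩ := hA1
  have hxS : ∀ k, x k ∈ S := by
    rintro (_ | k)
    exacts [halg.1, (halg.2.2.2.2.1 k).1]
  have hfin : ∀ w ∈ S, f (K w) = ((f (K w)).toReal : EReal) := fun w hw =>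
    (EReal.coe_toReal (interior_subset (hKint w hw)) (hfp.1 _)).symm
  have hbd : ∀ w ∈ S, m ≤ (f (K w)).toReal ∧ (f (K w)).toReal ≤ M := by
    intro w hw
    have h1 := hbound w hw
    rw [hfin w hw] at h1
    exact_mod_cast h1
  obtain ⟨fK, hfK_def⟩ : ∃ fK : E → ℝ, ∀ w, fK w = (f (K w)).toReal := ⟨_, fun _ => rfl⟩
  simp only [← hfK_def] at hfin hbd
  have hstep : Tendsto (fun k => ‖x (k + 1) - x k‖) atTop (𝓝 0) := by
    rcases S.subsingleton_or_nontrivial with hs | ⟨a, ha, b, hb, hab⟩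
    · simp [fun k => hs (hxS (k + 1)) (hxS k)]
    have hLh : 0 ≤ Lh :=
      nonneg_of_mul_nonneg_left ((norm_nonneg _).trans (hlip a (hSO ha) b (hSO hb)))
        (norm_pos_iff.2 (sub_ne_zero.2 hab))
    have hdiff : Tendsto (fun k => θ k - θ (k + 1)) atTop (𝓝 0) := by
      simpa using hθbar.sub (hθbar.comp (tendsto_add_atTop_nat 1))
    have hdecr := halg.sufficient_decrease hSconv (fun w hw => hgrad w (hSO hw))
      (fun v hv w hw => hlip v (hSO hv) w (hSO hw)) hγ hν hLh hβ hδ hxS (fun k => hfin _ (hxS k))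
    have hsq : Tendsto (fun k => ‖x (k + 1) - x k‖ ^ 2) atTop (𝓝 0) := by
      refine squeeze_zero (fun k => sq_nonneg _) (fun k => ?_)
        (g := fun k => |θ k - θ (k + 1)| * M / ν) (by simpa using (hdiff.abs.mul_const M).div_const ν)
      rw [le_div_iff₀ hν, mul_comm]
      have hb := hbd _ (hxS (k + 1))
      calc _ ≤ _ := hdecr k
        _ ≤ |θ k - θ (k + 1)| * fK (x (k + 1)) :=
          mul_le_mul_of_nonneg_right (le_abs_self _) (hm.le.trans hb.1)
        _ ≤ _ := mul_le_mul_of_nonneg_left hb.2 (abs_nonneg _)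
    simpa [Real.sqrt_sq (norm_nonneg _)] using hsq.sqrt
  obtain ⟨-, hz, hθ, hy, -, -⟩ := halg
  have hpsi : ∀ k, psi S g h A δ γ (x k) (z k) (u k) = ((θ k * fK (x k) : ℝ) : EReal) := by
    intro k
    rw [← (hθ k).2, hfin _ (hxS k), EReal.coe_mul]
  have hcontf : ContinuousOn fK S := by
    have h1 := ((convexOn_toReal_interior_edom hfp hfc).continuousOn isOpen_interior).comp
      K.continuous.continuousOn hKint
    exact h1.congr fun w _ => hfK_def w
  have hden : ∀ k, ((⟪K (x (k + 1)), y (k + 1)⟫ : ℝ) : EReal) - conj f (y (k + 1))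
      = ((fK (x k) + ⟪y (k + 1), K (x (k + 1)) - K (x k)⟫ : ℝ) : EReal) := by
    intro k
    rw [conj_eq_of_mem_subdiff f (hfin _ (hxS k)) (hy k), real_inner_comm, inner_sub_right]
    norm_cast
    ring
  refine ⟨?_, ?_⟩
  · rw [← tendsto_add_atTop_iff_nat 1]
    have hgam : ∀ k, gamPt S g h f A K δ γ (x (k + 1)) (y (k + 1)) (z (k + 1)) (u (k + 1))
        = ((θ (k + 1) * fK (x (k + 1)) /
          (fK (x k) + ⟪y (k + 1), K (x (k + 1)) - K (x k)⟫) : ℝ) : EReal) :=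
      fun k => gamPt_eq_coe_div (hpsi (k + 1)) (hden k)
    simp only [hgam]
    refine (continuous_coe_real_ereal.tendsto _).comp ?_
    obtain ⟨B, hB⟩ := exists_norm_le_of_mem_subdiff hfp hfc (hScomp.image K.continuous)
      (by rintro _ ⟨w, hw, rfl⟩; exact hKint w hw) (by
        rintro _ ⟨w, hw, rfl⟩
        rw [hfin w hw]
        exact_mod_cast hm.le.trans (hbd w hw).1)
    have hyB : ∀ k, ‖y (k + 1)‖ ≤ B := fun k => hB _ (mem_image_of_mem _ (hxS k)) _ (hy k)
    set D : ℕ → ℝ := fun k => fK (x k) + ⟪y (k + 1), K (x (k + 1)) - K (x k)⟫ with hD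
    have hDm : ∀ᶠ k in atTop, m ≤ D k ∧ D k ≤ fK (x (k + 1)) := by
      filter_upwards [eventually_ge_atTop K₁] with k hk
      have h1 := hK₁ (k + 1) (by omega)
      rw [hden, hfin _ (hxS (k + 1))] at h1
      exact ⟨by exact_mod_cast h1.1, by exact_mod_cast h1.2.1⟩
    have hupper : ∀ k, fK (x (k + 1)) - D k ≤ 2 * B * (‖K‖ * ‖x (k + 1) - x k‖) := by
      intro k
      have h1 := (mem_subdiff_iff_of_eq_coe f (hfin _ (hxS (k + 1)))).1 (hy (k + 1)) (K (x k))
      rw [hfin _ (hxS k), EReal.coe_le_coe_iff, ← neg_sub (K (x (k + 1))), inner_neg_right] at h1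
      have h2 : ‖K (x (k + 1)) - K (x k)‖ ≤ ‖K‖ * ‖x (k + 1) - x k‖ := by
        rw [← map_sub]
        exact K.le_opNorm _
      have h3 : ∀ j, |⟪y (j + 1), K (x (k + 1)) - K (x k)⟫| ≤ B * (‖K‖ * ‖x (k + 1) - x k‖) :=
        fun j => (abs_real_inner_le_norm _ _).trans
          (mul_le_mul (hyB j) h2 (norm_nonneg _) ((norm_nonneg _).trans (hyB j)))
      have h4 := abs_le.1 (h3 k)
      have h5 := abs_le.1 (h3 (k + 1))
      simp only [hD]
      linarith
    have hratio : Tendsto (fun k => (fK (x (k + 1)) - D k) / D k) atTop (𝓝 0) := by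
      refine squeeze_zero' (g := fun k => 2 * B * (‖K‖ * ‖x (k + 1) - x k‖) / m) ?_ ?_ ?_
      · filter_upwards [hDm] with k hk
        exact div_nonneg (sub_nonneg.2 hk.2) (hm.le.trans hk.1)
      · filter_upwards [hDm] with k hk
        exact div_le_div₀ ((sub_nonneg.2 hk.2).trans (hupper k)) (hupper k) hm hk.1
      · simpa using ((hstep.const_mul ‖K‖).const_mul (2 * B)).div_const m
    have hlim : Tendsto (fun k => θ (k + 1) * (1 + (fK (x (k + 1)) - D k) / D k)) atTop
        (𝓝 θbar) := by
      simpa using (hθbar.comp (tendsto_add_atTop_nat 1)).mul (hratio.const_add 1)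
    refine hlim.congr' ?_
    filter_upwards [hDm] with k hk
    have : D k ≠ 0 := (hm.trans_le hk.1).ne'
    change _ = θ (k + 1) * fK (x (k + 1)) / D k
    field_simp
    ring
  · intro xb yb zb ub φ hφ hxb hyb hzb hub
    have hxbS : xb ∈ S := hScomp.isClosed.mem_of_tendsto hxb (Eventually.of_forall fun j => hxS _)
    have hlimf : ∀ w : ℕ → E, (∀ j, w j ∈ S) → Tendsto w atTop (𝓝 xb) →
        Tendsto (fun j => fK (w j)) atTop (𝓝 (fK xb)) := fun w hwS hw =>
      (hcontf xb hxbS).tendsto.comp (tendsto_nhdsWithin_iff.2 ⟨hw, Eventually.of_forall hwS⟩)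
    have hxprev : Tendsto (fun j => x (φ j - 1)) atTop (𝓝 xb) := by
      have h1 : Tendsto (fun j => x (φ j) - x (φ j - 1)) atTop (𝓝 0) := by
        have h2 := (tendsto_zero_iff_norm_tendsto_zero.2 hstep).comp
          ((tendsto_sub_atTop_nat 1).comp hφ.tendsto_atTop)
        refine h2.congr' ?_
        filter_upwards [hφ.tendsto_atTop.eventually_ge_atTop 1] with j hj
        simp [Nat.sub_add_cancel hj]
      simpa using hxb.sub h1
    have hyb' : yb ∈ subdiff f (K xb) := by
      rw [mem_subdiff_iff_of_eq_coe f (hfin _ hxbS)]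
      intro w
      have h1 : Tendsto (fun j => ((fK (x (φ j - 1)) + ⟪y (φ j), w - K (x (φ j - 1))⟫ : ℝ) : EReal))
          atTop (𝓝 ((fK xb + ⟪yb, w - K xb⟫ : ℝ) : EReal)) :=
        (continuous_coe_real_ereal.tendsto _).comp ((hlimf _ (fun _ => hxS _) hxprev).add
          (hyb.inner (tendsto_const_nhds.sub ((K.continuous.tendsto _).comp hxprev))))
      refine le_of_tendsto h1 ?_
      filter_upwards [hφ.tendsto_atTop.eventually_ge_atTop 1] with j hj
      have h2 := hy (φ j - 1)
      rw [Nat.sub_add_cancel hj] at h2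
      exact (mem_subdiff_iff_of_eq_coe f (hfin _ (hxS _))).1 h2 w
    have hdb : ((⟪K xb, yb⟫ : ℝ) : EReal) - conj f yb = (fK xb : EReal) := by
      rw [conj_eq_of_mem_subdiff f (hfin _ hxbS) hyb', real_inner_comm]
      norm_cast
      ring
    have hAx : Tendsto (fun j => A (x (φ j))) atTop (𝓝 (A xb)) := (A.continuous.tendsto _).comp hxb
    have hconj := fun j => (psi_eq_coe_iff (hxS (φ j))).1 (hpsi (φ j))
    have hhb : Tendsto (fun j => h (x (φ j))) atTop (𝓝 (h xb)) :=
      ((hgrad xb (hSO hxbS)).continuousAt.tendsto).comp hxb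
    have hclim := (((((hzb.inner hAx).add hhb).add
      (((hxb.sub hub).norm.pow 2).const_mul (δ / 2))).sub
        ((hzb.norm.pow 2).const_mul (γ / 2))).sub
          ((hθbar.comp hφ.tendsto_atTop).mul (hlimf _ (fun _ => hxS _) hxb)))
    have hle := conj_le_of_tendsto g hzb hclim (Eventually.of_forall fun j => (hconj j).le)
    have hpsib : psi S g h A δ γ xb zb ub = ((θbar * fK xb : ℝ) : EReal) := by
      rw [psi_eq_coe_iff hxbS]
      refine le_antisymm hle ?_
      have hmin := fun j => hz (φ j) zb
      simp only [hconj] at hmin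
      induction hcb : conj g zb with
      | top => exact le_top
      | bot =>
        have h1 := hmin 0
        rw [hcb, EReal.bot_add, ← EReal.coe_add] at h1
        exact absurd h1 (EReal.bot_lt_coe _).not_ge
      | coe r =>
        simp only [hcb, ← EReal.coe_add, EReal.coe_le_coe_iff] at hmin ⊢
        have h1 := le_of_tendsto_of_tendsto'
          (hclim.add ((hzb.inner hAx).neg.add ((hzb.norm.pow 2).const_mul (γ / 2))))
          ((((tendsto_const_nhds (x := zb)).inner hAx).neg.add_const
            (γ / 2 * ‖zb‖ ^ 2)).const_add r) hmin
        linarith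
    rw [gamPt_eq_coe_div hpsib hdb, mul_div_cancel_right₀ _ (hm.trans_le (hbd xb hxbS).1).ne']

end FracPaper
end
end
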